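/- Let β ≥ 0 and W(x) = (1 + |x|)^β, μ(dx) = W(x)^{-1} dx. For each integer n ≥ 1, define λ_n = inf{ sup_{f ∈ F, f ≠ 0} D(f,f) / ∫_{ℝ^d} f² dμ : F an n-dimensional linear subspace of C_c^∞(ℝ^d) }. Then λ_n → ∞ as n → ∞ if and only if β > α. -/

import Mathlib

open MeasureTheory

/-- The fractional Dirichlet energy
`D(f,f) = ∫∫ (f(x) − f(y))² / |x − y|^{d+α} dx dy` on `ℝ^d`. -/
noncomputable def fracD (d : ℕ) (α : ℝ) (f : EuclideanSpace ℝ (Fin d) → ℝ) : ℝ :=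
  ∫ x, ∫ y, (f x - f y) ^ 2 / ‖x - y‖ ^ ((d : ℝ) + α)

/-- The Courant–Fischer min–max level
`λ_n = inf { sup_{0 ≠ f ∈ F} D(f,f)/∫ f² dμ : F ⊆ C_c^∞(ℝ^d), dim F = n }`,
where `μ(dx) = W(x)⁻¹ dx`. -/
noncomputable def minMaxLevel (d : ℕ) (α : ℝ) (W : EuclideanSpace ℝ (Fin d) → ℝ)
    (n : ℕ) : ℝ :=
  sInf { Λ : ℝ | ∃ F : Submodule ℝ (EuclideanSpace ℝ (Fin d) → ℝ),
    Module.finrank ℝ F = n ∧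
    (∀ f ∈ F, ContDiff ℝ (⊤ : ℕ∞) f ∧ HasCompactSupport f) ∧
    Λ = sSup { t : ℝ | ∃ f ∈ F, f ≠ 0 ∧
          t = fracD d α f / ∫ x, (f x) ^ 2 * (W x)⁻¹ } }

/-- Smooth compactly supported functions. -/
def Nice {d : ℕ} (f : EuclideanSpace ℝ (Fin d) → ℝ) : Prop :=
  ContDiff ℝ (⊤ : ℕ∞) f ∧ HasCompactSupport f

/-- The energy integrand. -/
noncomputable def qq (d : ℕ) (α : ℝ) (f : EuclideanSpace ℝ (Fin d) → ℝ)
    (p : EuclideanSpace ℝ (Fin d) × EuclideanSpace ℝ (Fin d)) : ℝ :=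
  (f p.1 - f p.2) ^ 2 / ‖p.1 - p.2‖ ^ ((d : ℝ) + α)

lemma qq_nonneg (d : ℕ) (α : ℝ) (f : EuclideanSpace ℝ (Fin d) → ℝ)
    (p : EuclideanSpace ℝ (Fin d) × EuclideanSpace ℝ (Fin d)) : 0 ≤ qq d α f p := by
  unfold qq; positivity

lemma kernel_int (d : ℕ) (hd0 : 0 < d) (α : ℝ) (hα : α ∈ Set.Ioo (0 : ℝ) 2) :
    Integrable (fun z : EuclideanSpace ℝ (Fin d) => min 1 (‖z‖ ^ 2) / ‖z‖ ^ ((d : ℝ) + α)) := by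
  obtain ⟨h0, h2⟩ := hα
  have : Nonempty (Fin d) := ⟨⟨0, hd0⟩⟩
  have : Nontrivial (EuclideanSpace ℝ (Fin d)) := inferInstance
  rw [integrable_fun_norm_addHaar (volume : Measure (EuclideanSpace ℝ (Fin d)))
    (f := fun r => min 1 (r ^ 2) / r ^ ((d : ℝ) + α))]
  rw [finrank_euclideanSpace_fin, ← Set.Ioc_union_Ioi_eq_Ioi (zero_le_one' ℝ)]
  have hpow : ∀ y : ℝ, 0 < y → y ^ (d - 1) = y ^ ((d : ℝ) - 1) := by
    intro y hy
    rw [← Real.rpow_natCast, Nat.cast_sub hd0, Nat.cast_one]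
  refine IntegrableOn.union ?_ ?_
  · have h1 : IntegrableOn (fun y : ℝ => y ^ (1 - α)) (Set.Ioc 0 1) := by
      rw [← intervalIntegrable_iff_integrableOn_Ioc_of_le zero_le_one]
      exact intervalIntegral.intervalIntegrable_rpow' (by linarith)
    refine h1.congr_fun ?_ measurableSet_Ioc
    intro y hy
    have hy0 := hy.1
    simp only [smul_eq_mul]
    rw [min_eq_right (by nlinarith [hy.2]), hpow y hy0, ← Real.rpow_natCast y 2,
      mul_div_assoc', ← Real.rpow_add hy0, ← Real.rpow_sub hy0]
    congr 1
    push_cast; ring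
  · have h1 : IntegrableOn (fun y : ℝ => y ^ (-1 - α)) (Set.Ioi 1) := by
      rw [integrableOn_Ioi_rpow_iff one_pos]; linarith
    refine h1.congr_fun ?_ measurableSet_Ioi
    intro y hy
    have hy1 : (1:ℝ) < y := hy
    have hy0 : 0 < y := by linarith
    simp only [smul_eq_mul]
    rw [min_eq_left (by nlinarith), hpow y hy0,
      mul_div_assoc', mul_one, ← Real.rpow_sub hy0]
    congr 1
    ring

lemma qq_aesm (d : ℕ) (α : ℝ) (f : EuclideanSpace ℝ (Fin d) → ℝ) (hf : Nice f) :
    AEStronglyMeasurable (qq d α f) (volume.prod volume) := by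
  have hc : Continuous f := hf.1.continuous
  have : Measurable (qq d α f) := by
    unfold qq
    refine Measurable.div ?_ ?_
    · exact (by fun_prop : Continuous fun p : EuclideanSpace ℝ (Fin d) × EuclideanSpace ℝ (Fin d) =>
        (f p.1 - f p.2) ^ 2).measurable
    · exact (by fun_prop : Continuous fun p : EuclideanSpace ℝ (Fin d) × EuclideanSpace ℝ (Fin d) =>
        ‖p.1 - p.2‖).measurable.pow_const _
  exact this.aestronglyMeasurable

lemma qq_int (d : ℕ) (hd0 : 0 < d) (α : ℝ) (hα : α ∈ Set.Ioo (0 : ℝ) 2)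
    (f : EuclideanSpace ℝ (Fin d) → ℝ) (hf : Nice f) :
    Integrable (qq d α f) (volume.prod volume) := by
  have hc : Continuous f := hf.1.continuous
  obtain ⟨L, hL⟩ := hf.1.lipschitzWith_of_hasCompactSupport hf.2 (by simp)
  obtain ⟨M, hM⟩ := hf.2.exists_bound_of_continuous hc
  have hM0 : 0 ≤ M := (norm_nonneg _).trans (hM 0)
  set K := tsupport f with hK
  have hKm : MeasurableSet K := (isClosed_tsupport f).measurableSet
  have hKc : IsCompact K := hf.2
  have hind : Integrable (K.indicator (fun _ => (1:ℝ))) (volume : Measure (EuclideanSpace ℝ (Fin d))) :=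
    (integrable_indicator_iff hKm).2 (integrableOn_const (hs := hKc.measure_lt_top.ne))
  have I1 := Integrable.convolution_integrand (ContinuousLinearMap.mul ℝ ℝ) hind (kernel_int d hd0 α hα)
    (μ := volume)
  have I2 := I1.swap
  have I3 := (I1.add I2).const_mul ((L:ℝ)^2 + 4 * M^2)
  refine I3.mono' (qq_aesm d α f hf) (Filter.Eventually.of_forall ?_)
  rintro ⟨x, y⟩
  rw [Real.norm_of_nonneg (qq_nonneg _ _ _ _)]
  simp only [Pi.add_apply, Function.comp, Prod.swap, ContinuousLinearMap.mul_apply']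
  rw [norm_sub_rev y x, ← add_mul, ← mul_assoc]
  unfold qq
  simp only
  rw [← mul_div_assoc]
  refine div_le_div_of_nonneg_right ?_ (by positivity)
  have hmn : 0 ≤ min 1 (‖x - y‖ ^ 2) := le_min zero_le_one (by positivity)
  by_cases hxy : x ∈ K ∨ y ∈ K
  · have h1 : (1:ℝ) ≤ K.indicator (fun _ => (1:ℝ)) y + K.indicator (fun _ => (1:ℝ)) x := by
      have a1 : 0 ≤ K.indicator (fun _ => (1:ℝ)) y := Set.indicator_nonneg (fun _ _ => zero_le_one) _
      have a2 : 0 ≤ K.indicator (fun _ => (1:ℝ)) x := Set.indicator_nonneg (fun _ _ => zero_le_one) _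
      rcases hxy with h | h
      · rw [Set.indicator_of_mem h] at *; linarith
      · rw [Set.indicator_of_mem h] at *; linarith
    have h2 : (f x - f y) ^ 2 ≤ ((L:ℝ)^2 + 4 * M^2) * min 1 (‖x - y‖ ^ 2) := by
      have b1 : |f x - f y| ≤ L * ‖x - y‖ := by
        have := hL.dist_le_mul x y
        rwa [dist_eq_norm, dist_eq_norm] at this
      have b2 : |f x - f y| ≤ 2 * M := by
        have := norm_sub_le (f x) (f y)
        rw [Real.norm_eq_abs] at this
        linarith [hM x, hM y]
      have c1 : (f x - f y) ^ 2 ≤ L^2 * ‖x - y‖^2 := by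
        rw [← mul_pow, ← sq_abs]; gcongr
      have c2 : (f x - f y) ^ 2 ≤ (2 * M)^2 := by
        rw [← sq_abs]; gcongr
      rcases min_cases 1 (‖x - y‖ ^ 2) with ⟨h, _⟩ | ⟨h, _⟩ <;> rw [h]
      · nlinarith [sq_nonneg (L:ℝ)]
      · have : 0 ≤ 4 * M^2 * ‖x-y‖^2 := by positivity
        nlinarith
    refine h2.trans ?_
    have : 0 ≤ ((L:ℝ)^2 + 4 * M^2) := by positivity
    calc ((L:ℝ)^2 + 4 * M^2) * min 1 (‖x - y‖ ^ 2)
        = ((L:ℝ)^2 + 4 * M^2) * 1 * min 1 (‖x - y‖ ^ 2) := by ring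
      _ ≤ _ := by gcongr
  · push Not at hxy
    rw [image_eq_zero_of_notMem_tsupport hxy.1, image_eq_zero_of_notMem_tsupport hxy.2]
    simp [hxy.1, hxy.2]

lemma fracD_eq (d : ℕ) (hd0 : 0 < d) (α : ℝ) (hα : α ∈ Set.Ioo (0 : ℝ) 2)
    (f : EuclideanSpace ℝ (Fin d) → ℝ) (hf : Nice f) :
    fracD d α f = ∫ p, qq d α f p ∂(volume.prod volume) := by
  rw [integral_prod _ (qq_int d hd0 α hα f hf)]
  rfl

lemma fracD_nonneg (d : ℕ) (α : ℝ) (f : EuclideanSpace ℝ (Fin d) → ℝ) : 0 ≤ fracD d α f := by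
  unfold fracD
  exact integral_nonneg fun x => integral_nonneg fun y => by positivity

lemma fracD_scale (d : ℕ) (α : ℝ) (f : EuclideanSpace ℝ (Fin d) → ℝ) (R : ℝ) (hR : 0 < R) :
    fracD d α (fun x => f (R⁻¹ • x)) = R ^ ((d : ℝ) - α) * fracD d α f := by
  unfold fracD
  have h : ∀ x y : EuclideanSpace ℝ (Fin d),
      (f (R⁻¹ • x) - f (R⁻¹ • y)) ^ 2 / ‖x - y‖ ^ ((d : ℝ) + α)
      = R ^ (-((d : ℝ) + α)) * ((f (R⁻¹ • x) - f (R⁻¹ • y)) ^ 2 / ‖R⁻¹ • x - R⁻¹ • y‖ ^ ((d : ℝ) + α)) := by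
    intro x y
    rw [← smul_sub, norm_smul, Real.norm_of_nonneg (inv_nonneg.2 hR.le),
      Real.mul_rpow (inv_nonneg.2 hR.le) (norm_nonneg _), Real.inv_rpow hR.le, Real.rpow_neg hR.le]
    have : R ^ ((d : ℝ) + α) ≠ 0 := (Real.rpow_pos_of_pos hR _).ne'
    field_simp
  simp_rw [h, integral_const_mul]
  have h1 : ∀ x : EuclideanSpace ℝ (Fin d),
      ∫ y, (f (R⁻¹ • x) - f (R⁻¹ • y)) ^ 2 / ‖R⁻¹ • x - R⁻¹ • y‖ ^ ((d : ℝ) + α)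
       = R ^ d * ∫ y, (f (R⁻¹ • x) - f y) ^ 2 / ‖R⁻¹ • x - y‖ ^ ((d : ℝ) + α) := by
    intro x
    have := Measure.integral_comp_inv_smul (volume : Measure (EuclideanSpace ℝ (Fin d)))
      (fun y => (f (R⁻¹ • x) - f y) ^ 2 / ‖R⁻¹ • x - y‖ ^ ((d : ℝ) + α)) R
    rw [this, finrank_euclideanSpace_fin, abs_of_pos (by positivity), smul_eq_mul]
  simp_rw [h1, integral_const_mul]
  have := Measure.integral_comp_inv_smul (volume : Measure (EuclideanSpace ℝ (Fin d)))
      (fun x => ∫ y, (f x - f y) ^ 2 / ‖x - y‖ ^ ((d : ℝ) + α)) R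
  rw [this, finrank_euclideanSpace_fin, abs_of_pos (by positivity), smul_eq_mul,
    ← mul_assoc, ← mul_assoc]
  congr 1
  rw [← Real.rpow_natCast, ← Real.rpow_add hR, ← Real.rpow_add hR]
  congr 1; ring

/-- Weighted square norm. -/
noncomputable def wN (d : ℕ) (β : ℝ) (f : EuclideanSpace ℝ (Fin d) → ℝ) : ℝ :=
  ∫ x, (f x) ^ 2 * ((1 + ‖x‖) ^ β)⁻¹

lemma w_cont (d : ℕ) (β : ℝ) :
    Continuous (fun x : EuclideanSpace ℝ (Fin d) => ((1 + ‖x‖) ^ β)⁻¹) := by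
  have h : ∀ x : EuclideanSpace ℝ (Fin d), 0 < 1 + ‖x‖ := fun x => by positivity
  refine Continuous.inv₀ (Continuous.rpow_const (by fun_prop) fun x => Or.inl (h x).ne') ?_
  intro x; exact (Real.rpow_pos_of_pos (h x) _).ne'

lemma w_pos (d : ℕ) (β : ℝ) (x : EuclideanSpace ℝ (Fin d)) : 0 < ((1 + ‖x‖) ^ β)⁻¹ := by
  positivity

lemma wprod_int (d : ℕ) (β : ℝ) (f g : EuclideanSpace ℝ (Fin d) → ℝ) (hf : Nice f) (hg : Nice g) :
    Integrable (fun x => f x * g x * ((1 + ‖x‖) ^ β)⁻¹) := by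
  have h1 := hf.1.continuous
  have h2 := hg.1.continuous
  refine Continuous.integrable_of_hasCompactSupport ((h1.mul h2).mul (w_cont d β)) ?_
  exact (hf.2.mul_right).mul_right

lemma wN_int (d : ℕ) (β : ℝ) (f : EuclideanSpace ℝ (Fin d) → ℝ) (hf : Nice f) :
    Integrable (fun x => (f x) ^ 2 * ((1 + ‖x‖) ^ β)⁻¹) := by
  have := wprod_int d β f f hf hf
  simpa only [sq] using this

lemma wN_nonneg (d : ℕ) (β : ℝ) (f : EuclideanSpace ℝ (Fin d) → ℝ) : 0 ≤ wN d β f :=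
  integral_nonneg fun x => mul_nonneg (sq_nonneg _) (w_pos d β x).le

lemma wN_pos (d : ℕ) (β : ℝ) (f : EuclideanSpace ℝ (Fin d) → ℝ) (hf : Nice f) (h0 : f ≠ 0) :
    0 < wN d β f := by
  obtain ⟨x, hx⟩ := Function.ne_iff.1 h0
  have h1 := hf.1.continuous
  refine Continuous.integral_pos_of_hasCompactSupport_nonneg_nonzero (x := x)
    ((h1.pow 2).mul (w_cont d β)) ?_ (fun y => mul_nonneg (sq_nonneg _) (w_pos d β y).le) ?_
  · have : HasCompactSupport (fun x => f x ^ 2) := hf.2.comp_left (g := fun t => t ^ 2) (by simp)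
    exact this.mul_right
  · exact mul_ne_zero (pow_ne_zero _ hx) (w_pos d β x).ne'

lemma nice_zero {d : ℕ} : Nice (0 : EuclideanSpace ℝ (Fin d) → ℝ) :=
  ⟨contDiff_const, HasCompactSupport.zero⟩

lemma nice_add {d : ℕ} {f g : EuclideanSpace ℝ (Fin d) → ℝ} (hf : Nice f) (hg : Nice g) :
    Nice (f + g) := ⟨hf.1.add hg.1, hf.2.add hg.2⟩

lemma nice_smul {d : ℕ} {f : EuclideanSpace ℝ (Fin d) → ℝ} (c : ℝ) (hf : Nice f) :
    Nice (c • f) := ⟨contDiff_const.smul hf.1, hf.2.smul_left⟩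

lemma nice_sum {d : ℕ} {ι : Type*} [Fintype ι] (c : ι → ℝ) (f : ι → EuclideanSpace ℝ (Fin d) → ℝ)
    (hf : ∀ i, Nice (f i)) : Nice (∑ i, c i • f i) :=
  Finset.sum_induction _ Nice (fun _ _ => nice_add) nice_zero fun i _ => nice_smul _ (hf i)

lemma fracD_sum_le (d : ℕ) (hd0 : 0 < d) (α : ℝ) (hα : α ∈ Set.Ioo (0 : ℝ) 2)
    {ι : Type*} [Fintype ι] (c : ι → ℝ) (f : ι → EuclideanSpace ℝ (Fin d) → ℝ)
    (hf : ∀ i, Nice (f i)) (m : ℝ)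
    (hm : ∀ x y, (∑ i, c i * (f i x - f i y)) ^ 2 ≤ m * ∑ i, (c i * (f i x - f i y)) ^ 2) :
    fracD d α (∑ i, c i • f i) ≤ m * ∑ i, c i ^ 2 * fracD d α (f i) := by
  rw [fracD_eq d hd0 α hα _ (nice_sum c f hf)]
  simp_rw [fun i => fracD_eq d hd0 α hα _ (hf i), ← integral_const_mul]
  rw [← integral_finsetSum _ fun i _ => (qq_int d hd0 α hα _ (hf i)).const_mul _, ← integral_const_mul]
  refine integral_mono (qq_int d hd0 α hα _ (nice_sum c f hf)) ?_ ?_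
  · exact (integrable_finsetSum _ fun i _ => (qq_int d hd0 α hα _ (hf i)).const_mul _).const_mul _
  · rintro ⟨x, y⟩
    simp only [qq]
    simp_rw [← mul_div_assoc, ← mul_pow]
    rw [← Finset.sum_div, ← mul_div_assoc]
    refine div_le_div_of_nonneg_right ?_ (by positivity)
    refine le_trans (le_of_eq ?_) (hm x y)
    simp [Finset.sum_apply, mul_sub]

lemma wN_sum (d : ℕ) (β : ℝ)
    {ι : Type*} [Fintype ι] (c : ι → ℝ) (f : ι → EuclideanSpace ℝ (Fin d) → ℝ)
    (hf : ∀ i, Nice (f i)) :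
    wN d β (∑ i, c i • f i) = ∑ i, ∑ j, c i * c j * ∫ x, f i x * f j x * ((1 + ‖x‖) ^ β)⁻¹ := by
  simp_rw [← integral_const_mul]
  have hI : ∀ i j, Integrable (fun x => c i * c j * (f i x * f j x * ((1 + ‖x‖) ^ β)⁻¹)) :=
    fun i j => (wprod_int d β _ _ (hf i) (hf j)).const_mul _
  simp_rw [fun i => (integral_finsetSum Finset.univ fun j _ => hI i j).symm]
  rw [← integral_finsetSum _ fun i _ => integrable_finsetSum _ fun j _ => hI i j]
  unfold wN
  congr 1
  ext x
  simp only [Finset.sum_apply, Pi.smul_apply, smul_eq_mul, sq, Finset.sum_mul_sum]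
  simp only [Finset.sum_mul]
  refine Finset.sum_congr rfl fun i _ => Finset.sum_congr rfl fun j _ => by ring

lemma quot_bdd (d : ℕ) (hd0 : 0 < d) (α β : ℝ) (hα : α ∈ Set.Ioo (0 : ℝ) 2)
    (F : Submodule ℝ (EuclideanSpace ℝ (Fin d) → ℝ)) (hF : 0 < Module.finrank ℝ F)
    (hFn : ∀ f ∈ F, Nice f) :
    BddAbove { t : ℝ | ∃ f ∈ F, f ≠ 0 ∧ t = fracD d α f / wN d β f } := by
  have : FiniteDimensional ℝ F := Module.finite_of_finrank_pos hF
  set n := Module.finrank ℝ F with hn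
  let b := Module.finBasis ℝ F
  let g : Fin n → EuclideanSpace ℝ (Fin d) → ℝ := fun i => (b i : EuclideanSpace ℝ (Fin d) → ℝ)
  have hg : ∀ i, Nice (g i) := fun i => hFn _ (b i).2
  let N : (Fin n → ℝ) → ℝ := fun c => wN d β (∑ i, c i • g i)
  have hNc : Continuous N := by
    simp only [N, wN_sum d β _ g hg]
    fun_prop
  have hne : ∀ c : Fin n → ℝ, c ≠ 0 → (∑ i, c i • g i) ≠ 0 := by
    intro c hc h
    apply hc
    have h' : ∑ i, c i • b i = 0 := by
      apply Subtype.ext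
      simpa [g] using h
    have := Fintype.linearIndependent_iff.1 b.linearIndependent c h'
    ext i; exact this i
  have : Nonempty (Fin n) := ⟨⟨0, hF⟩⟩
  obtain ⟨c0, hc0, hmin⟩ := (isCompact_sphere (0 : Fin n → ℝ) 1).exists_isMinOn
    (NormedSpace.sphere_nonempty.2 zero_le_one) hNc.continuousOn
  have hc0' : c0 ≠ 0 := by
    rintro rfl; simp at hc0
  have hκ : 0 < N c0 := wN_pos d β _ (nice_sum c0 g hg) (hne c0 hc0')
  have hhom : ∀ (t : ℝ) c, N (t • c) = t ^ 2 * N c := by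
    intro t c
    simp only [N, wN_sum d β _ g hg, Finset.mul_sum, Pi.smul_apply, smul_eq_mul]
    refine Finset.sum_congr rfl fun i _ => Finset.sum_congr rfl fun j _ => by ring
  have hlow : ∀ c, c ≠ 0 → N c0 * ‖c‖ ^ 2 ≤ N c := by
    intro c hc
    have hcn : ‖c‖ ≠ 0 := norm_ne_zero_iff.2 hc
    have h1 : ‖c‖⁻¹ • c ∈ Metric.sphere (0 : Fin n → ℝ) 1 := by
      simp [norm_smul, hcn]
    have h2 : N c0 ≤ N (‖c‖⁻¹ • c) := hmin h1
    rw [hhom] at h2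
    have : 0 < ‖c‖ ^ 2 := by positivity
    calc N c0 * ‖c‖ ^ 2 ≤ (‖c‖⁻¹ ^ 2 * N c) * ‖c‖ ^ 2 := by gcongr
      _ = N c := by field_simp
  refine ⟨n * (∑ i, fracD d α (g i)) / N c0, ?_⟩
  rintro t ⟨f, hfF, hf0, rfl⟩
  obtain ⟨c, rfl⟩ : ∃ c : Fin n → ℝ, ∑ i, c i • g i = f := by
    refine ⟨b.repr ⟨f, hfF⟩, ?_⟩
    have := congrArg (Subtype.val) (b.sum_repr ⟨f, hfF⟩)
    rw [Submodule.coe_sum] at this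
    exact this
  have hc : c ≠ 0 := by
    rintro rfl; simp at hf0
  have hD : fracD d α (∑ i, c i • g i) ≤ n * ∑ i, c i ^ 2 * fracD d α (g i) := by
    refine fracD_sum_le d hd0 α hα c g hg n fun x y => ?_
    have := sq_sum_le_card_mul_sum_sq (s := Finset.univ) (f := fun i => c i * (g i x - g i y))
    simpa using this
  have hD2 : fracD d α (∑ i, c i • g i) ≤ (n * ∑ i, fracD d α (g i)) * ‖c‖ ^ 2 := by
    refine hD.trans ?_
    rw [mul_assoc, Finset.sum_mul]
    refine mul_le_mul_of_nonneg_left (Finset.sum_le_sum fun i _ => ?_) (by positivity)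
    rw [mul_comm]
    refine mul_le_mul_of_nonneg_left ?_ (fracD_nonneg _ _ _)
    rw [← sq_abs]
    have := norm_le_pi_norm c i
    rw [Real.norm_eq_abs] at this
    gcongr
  have hl := hlow c hc
  have hNp : 0 < wN d β (∑ i, c i • g i) := wN_pos d β _ (nice_sum c g hg) hf0
  rw [div_le_div_iff₀ hNp hκ]
  have hS : 0 ≤ (n * ∑ i, fracD d α (g i)) :=
    mul_nonneg (by positivity) (Finset.sum_nonneg fun i _ => fracD_nonneg _ _ _)
  calc _ ≤ ((n * ∑ i, fracD d α (g i)) * ‖c‖ ^ 2) * N c0 := by gcongr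
    _ = (n * ∑ i, fracD d α (g i)) * (N c0 * ‖c‖ ^ 2) := by ring
    _ ≤ _ := by gcongr

/-- A family of disjointly supported test functions at dyadic scales. -/
lemma exists_family (d : ℕ) (hd0 : 0 < d) :
    ∃ (φ : EuclideanSpace ℝ (Fin d) → ℝ), Nice φ ∧ φ ≠ 0 ∧ 
      ∀ x, φ x ≠ 0 → 2 < ‖x‖ ∧ ‖x‖ < 4 := by
  have : Nonempty (Fin d) := ⟨⟨0, hd0⟩⟩
  obtain ⟨c, hc⟩ := exists_norm_eq (EuclideanSpace ℝ (Fin d)) (c := 3) (by norm_num)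
  let φ : ContDiffBump c := ⟨1/2, 1, by norm_num, by norm_num⟩
  refine ⟨φ, ⟨φ.contDiff, φ.hasCompactSupport⟩, ?_, ?_⟩
  · intro h
    have h1 : φ c = 1 := φ.one_of_mem_closedBall (by simp [φ])
    rw [h] at h1; simp at h1
  · intro x hx
    have hx' : x ∈ Function.support φ := hx
    rw [φ.support_eq] at hx'
    have h1 : ‖x - c‖ < 1 := by simpa [φ, dist_eq_norm] using hx'
    have h2 := norm_sub_norm_le x c
    have h3 := norm_sub_norm_le c x
    rw [norm_sub_rev] at h3
    constructor <;> linarith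

lemma nice_scale {d : ℕ} (φ : EuclideanSpace ℝ (Fin d) → ℝ) (h : Nice φ) (R : ℝ) (hR : 0 < R) :
    Nice (fun x => φ (R⁻¹ • x)) :=
  ⟨h.1.comp (contDiff_id.const_smul R⁻¹), h.2.comp_smul (inv_ne_zero hR.ne')⟩

lemma good_space (d : ℕ) (hd0 : 0 < d) (α : ℝ) (hα : α ∈ Set.Ioo (0 : ℝ) 2) :
    ∃ C : ℝ, 0 ≤ C ∧ ∀ n : ℕ, ∃ F : Submodule ℝ (EuclideanSpace ℝ (Fin d) → ℝ),
      Module.finrank ℝ F = n ∧ (∀ f ∈ F, Nice f) ∧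
      ∀ f ∈ F, ∀ β ≤ α, fracD d α f ≤ C * wN d β f := by
  obtain ⟨φ, hφ, hφ0, hsupp⟩ := exists_family d hd0
  have hI := wN_pos d 0 φ hφ hφ0
  have hI0 : wN d 0 φ = ∫ x, φ x ^ 2 := by simp [wN]
  set C := 5 ^ α * fracD d α φ / wN d 0 φ with hC
  have hC0 : 0 ≤ C := div_nonneg (mul_nonneg (by positivity) (fracD_nonneg _ _ _)) hI.le
  refine ⟨2 * C, by positivity, fun n => ?_⟩
  let g : Fin n → EuclideanSpace ℝ (Fin d) → ℝ := fun k x => φ (((2:ℝ) ^ (k:ℕ))⁻¹ • x)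
  have hg : ∀ k, Nice (g k) := fun k => nice_scale φ hφ _ (by positivity)
  have hgs : ∀ k x, g k x ≠ 0 → 2 ^ (k:ℕ) * 2 < ‖x‖ ∧ ‖x‖ < 2 ^ (k:ℕ) * 4 := by
    intro k x hx
    have := hsupp _ hx
    rw [norm_smul, norm_inv, Real.norm_of_nonneg (by positivity : (0:ℝ) ≤ 2 ^ (k:ℕ))] at this
    have h2 : (0:ℝ) < 2 ^ (k:ℕ) := by positivity
    rw [inv_mul_eq_div, lt_div_iff₀ h2, div_lt_iff₀ h2] at this
    constructor <;> linarith
  have huniq : ∀ x i j, g i x ≠ 0 → g j x ≠ 0 → i = j := by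
    have key : ∀ x (i j : Fin n), g i x ≠ 0 → g j x ≠ 0 → ¬ i < j := by
      intro x i j hi hj hij
      have h1 := (hgs i x hi).2
      have h2 := (hgs j x hj).1
      have : (2:ℝ) ^ ((i:ℕ)+1) ≤ 2 ^ (j:ℕ) := pow_le_pow_right₀ (by norm_num) hij
      rw [pow_succ] at this
      linarith
    intro x i j hi hj
    rcases lt_trichotomy i j with h | h | h
    · exact (key x i j hi hj h).elim
    · exact h
    · exact (key x j i hj hi h).elim
  have hdisj : ∀ x i j, i ≠ j → g i x * g j x = 0 := by
    intro x i j hij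
    by_contra h
    exact hij (huniq x i j (left_ne_zero_of_mul h) (right_ne_zero_of_mul h))
  have hwsum : ∀ β (c : Fin n → ℝ), wN d β (∑ i, c i • g i) = ∑ i, c i ^ 2 * wN d β (g i) := by
    intro β c
    rw [wN_sum d β c g hg]
    refine Finset.sum_congr rfl fun i _ => ?_
    rw [Finset.sum_eq_single i]
    · simp [wN, sq]
    · intro j _ hj
      simp [hdisj _ _ _ hj.symm]
    · simp
  have hgne : ∀ k, g k ≠ 0 := by
    intro k h
    apply hφ0
    ext x
    have := congrFun h ((2:ℝ) ^ (k:ℕ) • x)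
    simpa [g] using this
  have hli : LinearIndependent ℝ g := by
    rw [Fintype.linearIndependent_iff]
    intro c hc i
    have h1 := hwsum 0 c
    rw [hc] at h1
    have h2 : wN d 0 (0 : EuclideanSpace ℝ (Fin d) → ℝ) = 0 := by simp [wN]
    rw [h2] at h1
    have h3 := (Finset.sum_eq_zero_iff_of_nonneg
      (fun i _ => mul_nonneg (sq_nonneg _) (wN_nonneg d 0 _))).1 h1.symm i (Finset.mem_univ _)
    have h4 := wN_pos d 0 _ (hg i) (hgne i)
    simpa [h4.ne'] using h3
  refine ⟨Submodule.span ℝ (Set.range g), ?_, ?_, ?_⟩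
  · rw [finrank_span_eq_card hli, Fintype.card_fin]
  · intro f hf
    obtain ⟨c, rfl⟩ := (Submodule.mem_span_range_iff_exists_fun ℝ).1 hf
    exact nice_sum c g hg
  intro f hf β hβ
  obtain ⟨c, rfl⟩ := (Submodule.mem_span_range_iff_exists_fun ℝ).1 hf
  have hone : ∀ k, fracD d α (g k) ≤ C * wN d β (g k) := by
    intro k
    set R : ℝ := 2 ^ (k:ℕ) with hR
    have hR0 : 0 < R := by positivity
    have hR1 : 1 ≤ R := one_le_pow₀ (by norm_num)
    have e1 : fracD d α (g k) = R ^ ((d:ℝ) - α) * fracD d α φ := fracD_scale d α φ R hR0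
    have e2 : ∫ x, g k x ^ 2 = R ^ d * wN d 0 φ := by
      have := Measure.integral_comp_inv_smul (volume : Measure (EuclideanSpace ℝ (Fin d)))
        (fun x => φ x ^ 2) R
      rw [hI0]
      rw [finrank_euclideanSpace_fin, abs_of_pos (by positivity), smul_eq_mul] at this
      exact this
    have e3 : (5 * R) ^ (-α) * ∫ x, g k x ^ 2 ≤ wN d β (g k) := by
      rw [← integral_const_mul]
      have i1 := wN_int d 0 (g k) (hg k)
      simp only [Real.rpow_zero, inv_one, mul_one] at i1
      refine integral_mono (i1.const_mul _) (wN_int d β (g k) (hg k)) fun x => ?_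
      simp only
      by_cases hx : g k x = 0
      · simp [hx]
      rw [mul_comm]
      refine mul_le_mul_of_nonneg_left ?_ (sq_nonneg _)
      rw [Real.rpow_neg (by positivity)]
      refine inv_anti₀ (by positivity) ?_
      have hx4 := (hgs k x hx).2
      calc (1 + ‖x‖) ^ β ≤ (1 + ‖x‖) ^ α :=
            Real.rpow_le_rpow_of_exponent_le (by linarith [norm_nonneg x]) hβ
        _ ≤ (5 * R) ^ α := by
            refine Real.rpow_le_rpow (by positivity) ?_ hα.1.le
            linarith
    rw [e2] at e3
    refine le_trans (le_of_eq ?_) (mul_le_mul_of_nonneg_left e3 hC0)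
    rw [e1, hC, Real.mul_rpow (by norm_num) hR0.le, Real.rpow_neg (by norm_num), Real.rpow_neg hR0.le,
      Real.rpow_sub hR0, Real.rpow_natCast]
    have : (5:ℝ) ^ α ≠ 0 := by positivity
    field_simp
  have hD : fracD d α (∑ i, c i • g i) ≤ 2 * ∑ i, c i ^ 2 * fracD d α (g i) := by
    refine fracD_sum_le d hd0 α hα c g hg 2 fun x y => ?_
    classical
    set a : Fin n → ℝ := fun i => c i * (g i x - g i y) with ha
    change (∑ i, a i) ^ 2 ≤ 2 * ∑ i, a i ^ 2
    set s := Finset.univ.filter (fun i => g i x ≠ 0) ∪ Finset.univ.filter (fun i => g i y ≠ 0) with hs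
    have hcard : s.card ≤ 2 := by
      refine (Finset.card_union_le _ _).trans ?_
      have h1 : ∀ z, (Finset.univ.filter (fun i => g i z ≠ 0)).card ≤ 1 := by
        intro z
        rw [Finset.card_le_one]
        intro i hi j hj
        exact huniq z i j (by simpa using hi) (by simpa using hj)
      have := h1 x
      have := h1 y
      omega
    have hz : ∀ i, i ∉ s → a i = 0 := by
      intro i hi
      simp only [hs, Finset.mem_union, Finset.mem_filter, Finset.mem_univ, true_and, not_or, not_not] at hi
      simp [ha, hi.1, hi.2]
    have es : ∑ i, a i = ∑ i ∈ s, a i :=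
      (Finset.sum_subset (Finset.subset_univ s) fun i _ hi => hz i hi).symm
    rw [es]
    have h1 := sq_sum_le_card_mul_sum_sq (s := s) (f := a)
    have h2 : ∑ i ∈ s, a i ^ 2 ≤ ∑ i, a i ^ 2 :=
      Finset.sum_le_sum_of_subset_of_nonneg (Finset.subset_univ s) fun i _ _ => sq_nonneg _
    have h3 : (s.card : ℝ) ≤ 2 := by exact_mod_cast hcard
    have h4 : 0 ≤ ∑ i ∈ s, a i ^ 2 := Finset.sum_nonneg fun i _ => sq_nonneg _
    nlinarith
  refine hD.trans ?_
  rw [hwsum, mul_assoc, Finset.mul_sum Finset.univ _ C]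
  refine mul_le_mul_of_nonneg_left (Finset.sum_le_sum fun i _ => ?_) (by norm_num)
  calc _ ≤ c i ^ 2 * (C * wN d β (g i)) := mul_le_mul_of_nonneg_left (hone i) (sq_nonneg _)
    _ = _ := by ring

lemma nice_int {d : ℕ} {f : EuclideanSpace ℝ (Fin d) → ℝ} (hf : Nice f) : Integrable f :=
  hf.1.continuous.integrable_of_hasCompactSupport hf.2

lemma nice_sq_int {d : ℕ} {f : EuclideanSpace ℝ (Fin d) → ℝ} (hf : Nice f) :
    Integrable (fun x => f x ^ 2) := by
  have := wN_int d 0 f hf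
  simpa using this

lemma qq_sub (d : ℕ) (hd0 : 0 < d) (α : ℝ) (hα : α ∈ Set.Ioo (0 : ℝ) 2)
    (f : EuclideanSpace ℝ (Fin d) → ℝ) (hf : Nice f) {ι : Type*} (t : Finset ι)
    (S : ι → Set (EuclideanSpace ℝ (Fin d) × EuclideanSpace ℝ (Fin d)))
    (hS : ∀ i, MeasurableSet (S i)) (hdis : ∀ i j p, p ∈ S i → p ∈ S j → i = j) :
    ∑ i ∈ t, ∫ p in S i, qq d α f p ∂(volume.prod volume) ≤ fracD d α f := by
  have hI := qq_int d hd0 α hα f hf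
  rw [fracD_eq d hd0 α hα f hf, ← integral_biUnion_finset t (fun i _ => hS i) ?_
    (fun i _ => hI.integrableOn)]
  · exact setIntegral_le_integral hI (Filter.Eventually.of_forall (qq_nonneg d α f))
  · intro i _ j _ hij
    exact Set.disjoint_left.2 fun p hi hj => hij (hdis i j p hi hj)

lemma sq_le_qq (d : ℕ) (α : ℝ) (hα : 0 < α) (f : EuclideanSpace ℝ (Fin d) → ℝ)
    (x y : EuclideanSpace ℝ (Fin d)) (ρ : ℝ) (h : ‖x - y‖ ≤ ρ) :
    (f x - f y) ^ 2 ≤ ρ ^ ((d:ℝ) + α) * qq d α f (x, y) := by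
  unfold qq
  simp only
  by_cases hxy : x = y
  · subst hxy; simp
  have hp : 0 < ‖x - y‖ := norm_pos_iff.2 (sub_ne_zero.2 hxy)
  have hp' : 0 < ‖x - y‖ ^ ((d:ℝ) + α) := Real.rpow_pos_of_pos hp _
  rw [← mul_div_assoc, le_div_iff₀ hp', mul_comm]
  refine mul_le_mul_of_nonneg_right ?_ (sq_nonneg _)
  exact Real.rpow_le_rpow hp.le h (by positivity)

lemma hardy_step (d : ℕ) (hd0 : 0 < d) (α : ℝ) (hα : α ∈ Set.Ioo (0 : ℝ) 2)
    (f : EuclideanSpace ℝ (Fin d) → ℝ) (hf : Nice f)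
    (A B : Set (EuclideanSpace ℝ (Fin d))) (hA : MeasurableSet A) (hB : MeasurableSet B)
    (hAf : volume A ≠ ⊤) (hBf : volume B ≠ ⊤) (ρ ε : ℝ) (hε : 0 < ε)
    (hρ : ∀ x ∈ A, ∀ y ∈ B, ‖x - y‖ ≤ ρ) :
    volume.real B * ∫ x in A, f x ^ 2 ≤
      (1 + 1 / ε) * ρ ^ ((d:ℝ) + α) * ∫ p in A ×ˢ B, qq d α f p ∂(volume.prod volume)
      + (1 + ε) * volume.real A * ∫ y in B, f y ^ 2 := by
  have hI := (qq_int d hd0 α hα f hf).integrableOn (s := A ×ˢ B)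
  have e1 : ∫ p in A ×ˢ B, f p.1 ^ 2 * (1:ℝ) ∂(volume.prod volume) = (∫ x in A, f x ^ 2) * ∫ y in B, (1:ℝ) :=
    setIntegral_prod_mul (fun x => f x ^ 2) (fun _ => (1:ℝ)) A B
  have e2 : ∫ p in A ×ˢ B, (1:ℝ) * f p.2 ^ 2 ∂(volume.prod volume) = (∫ x in A, (1:ℝ)) * ∫ y in B, f y ^ 2 :=
    setIntegral_prod_mul (fun _ => (1:ℝ)) (fun x => f x ^ 2) A B
  have o1 : Integrable (fun _ : EuclideanSpace ℝ (Fin d) => (1:ℝ)) (volume.restrict A) :=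
    integrableOn_const (hs := hAf)
  have o2 : Integrable (fun _ : EuclideanSpace ℝ (Fin d) => (1:ℝ)) (volume.restrict B) :=
    integrableOn_const (hs := hBf)
  have i1 : IntegrableOn (fun p : EuclideanSpace ℝ (Fin d) × EuclideanSpace ℝ (Fin d) => f p.1 ^ 2 * (1:ℝ))
      (A ×ˢ B) (volume.prod volume) := by
    rw [IntegrableOn, ← Measure.prod_restrict]
    exact (nice_sq_int hf).restrict.mul_prod o2
  have i2 : IntegrableOn (fun p : EuclideanSpace ℝ (Fin d) × EuclideanSpace ℝ (Fin d) => (1:ℝ) * f p.2 ^ 2)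
      (A ×ˢ B) (volume.prod volume) := by
    rw [IntegrableOn, ← Measure.prod_restrict]
    exact o1.mul_prod (nice_sq_int hf).restrict
  rw [setIntegral_const, smul_eq_mul, mul_one] at e1 e2
  rw [mul_comm, ← e1, mul_assoc (1 + ε), ← e2, ← integral_const_mul, ← integral_const_mul,
    ← integral_add (hI.const_mul _) (i2.const_mul _)]
  refine setIntegral_mono_on i1 ((hI.const_mul _).add (i2.const_mul _)) (hA.prod hB) ?_
  rintro ⟨x, y⟩ ⟨hx, hy⟩
  simp only [mul_one, one_mul]
  have h1 := sq_le_qq d α hα.1 f x y ρ (hρ x hx y hy)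
  have h2 : f x ^ 2 ≤ (1 + 1 / ε) * (f x - f y) ^ 2 + (1 + ε) * f y ^ 2 := by
    have : (1 + 1 / ε) * (f x - f y) ^ 2 + (1 + ε) * f y ^ 2 - f x ^ 2
        = (1 / ε) * ((f x - f y) - ε * f y) ^ 2 := by
      field_simp; ring
    have h3 : 0 ≤ (1 / ε) * ((f x - f y) - ε * f y) ^ 2 := by positivity
    linarith
  refine h2.trans ?_
  rw [mul_assoc]
  gcongr

lemma poincare_step (d : ℕ) (hd0 : 0 < d) (α : ℝ) (hα : α ∈ Set.Ioo (0 : ℝ) 2)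
    (f : EuclideanSpace ℝ (Fin d) → ℝ) (hf : Nice f)
    (A : Set (EuclideanSpace ℝ (Fin d))) (hA : MeasurableSet A)
    (hAf : volume A ≠ ⊤) (ρ : ℝ)
    (hρ : ∀ x ∈ A, ∀ y ∈ A, ‖x - y‖ ≤ ρ) (h0 : ∫ x in A, f x = 0) :
    2 * volume.real A * ∫ x in A, f x ^ 2 ≤
      ρ ^ ((d:ℝ) + α) * ∫ p in A ×ˢ A, qq d α f p ∂(volume.prod volume) := by
  have hI := (qq_int d hd0 α hα f hf).integrableOn (s := A ×ˢ A)
  have e1 : ∫ p in A ×ˢ A, f p.1 ^ 2 * (1:ℝ) ∂(volume.prod volume) = (∫ x in A, f x ^ 2) * ∫ y in A, (1:ℝ) :=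
    setIntegral_prod_mul (fun x => f x ^ 2) (fun _ => (1:ℝ)) A A
  have e2 : ∫ p in A ×ˢ A, (1:ℝ) * f p.2 ^ 2 ∂(volume.prod volume) = (∫ x in A, (1:ℝ)) * ∫ y in A, f y ^ 2 :=
    setIntegral_prod_mul (fun _ => (1:ℝ)) (fun x => f x ^ 2) A A
  have e3 : ∫ p in A ×ˢ A, f p.1 * f p.2 ∂(volume.prod volume) = (∫ x in A, f x) * ∫ y in A, f y :=
    setIntegral_prod_mul (fun x => f x) (fun x => f x) A A
  have o1 : Integrable (fun _ : EuclideanSpace ℝ (Fin d) => (1:ℝ)) (volume.restrict A) :=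
    integrableOn_const (hs := hAf)
  have i1 : IntegrableOn (fun p : EuclideanSpace ℝ (Fin d) × EuclideanSpace ℝ (Fin d) => f p.1 ^ 2 * (1:ℝ))
      (A ×ˢ A) (volume.prod volume) := by
    rw [IntegrableOn, ← Measure.prod_restrict]
    exact (nice_sq_int hf).restrict.mul_prod o1
  have i2 : IntegrableOn (fun p : EuclideanSpace ℝ (Fin d) × EuclideanSpace ℝ (Fin d) => (1:ℝ) * f p.2 ^ 2)
      (A ×ˢ A) (volume.prod volume) := by
    rw [IntegrableOn, ← Measure.prod_restrict]
    exact o1.mul_prod (nice_sq_int hf).restrict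
  have i3 : IntegrableOn (fun p : EuclideanSpace ℝ (Fin d) × EuclideanSpace ℝ (Fin d) => f p.1 * f p.2)
      (A ×ˢ A) (volume.prod volume) := by
    rw [IntegrableOn, ← Measure.prod_restrict]
    exact (nice_int hf).restrict.mul_prod (nice_int hf).restrict
  rw [setIntegral_const, smul_eq_mul, mul_one] at e1 e2
  rw [h0, zero_mul] at e3
  have key : 2 * volume.real A * ∫ x in A, f x ^ 2 =
      ∫ p in A ×ˢ A, ((f p.1 ^ 2 * (1:ℝ) + (1:ℝ) * f p.2 ^ 2) - 2 * (f p.1 * f p.2)) ∂(volume.prod volume) := by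
    have k1 := integral_sub (i1.add i2) (i3.const_mul 2)
    have k2 := integral_add i1 i2
    simp only [Pi.add_apply] at k1
    rw [k1, k2, e1, e2, integral_const_mul, e3]
    ring
  rw [key, ← integral_const_mul]
  refine setIntegral_mono_on ((i1.add i2).sub (i3.const_mul 2)) (hI.const_mul _) (hA.prod hA) ?_
  rintro ⟨x, y⟩ ⟨hx, hy⟩
  have h1 := sq_le_qq d α hα.1 f x y ρ (hρ x hx y hy)
  refine le_trans (le_of_eq ?_) h1
  simp only; ring

/-- Dyadic annuli. -/
def ann (d : ℕ) (k : ℕ) : Set (EuclideanSpace ℝ (Fin d)) := {x | (2:ℝ) ^ k ≤ ‖x‖ ∧ ‖x‖ < 2 ^ (k + 1)}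

lemma ann_meas (d k : ℕ) : MeasurableSet (ann d k) :=
  (measurableSet_Ico (a := (2:ℝ) ^ k) (b := 2 ^ (k + 1))).preimage measurable_norm

lemma ann_uniq (d : ℕ) (i j : ℕ) (x : EuclideanSpace ℝ (Fin d)) (hi : x ∈ ann d i) (hj : x ∈ ann d j) :
    i = j := by
  have key : ∀ i j, x ∈ ann d i → x ∈ ann d j → ¬ i < j := by
    intro i j hi hj hij
    have : (2:ℝ) ^ (i+1) ≤ 2 ^ j := pow_le_pow_right₀ (by norm_num) hij
    linarith [hi.2, hj.1]
  rcases lt_trichotomy i j with h | h | h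
  · exact (key i j hi hj h).elim
  · exact h
  · exact (key j i hj hi h).elim

lemma ann_vol (d : ℕ) (hd0 : 0 < d) : ∃ v : ℝ, 0 < v ∧ ∀ k, volume (ann d k) ≠ ⊤ ∧
    volume.real (ann d k) = ((2:ℝ) ^ k) ^ d * v := by
  have : Nonempty (Fin d) := ⟨⟨0, hd0⟩⟩
  set V := volume.real (Metric.ball (0 : EuclideanSpace ℝ (Fin d)) 1) with hV
  have hV0 : 0 < V := by
    refine ENNReal.toReal_pos (Metric.measure_ball_pos _ _ one_pos).ne' measure_ball_lt_top.ne
  have hball : ∀ r : ℝ, 0 ≤ r → volume.real (Metric.ball (0 : EuclideanSpace ℝ (Fin d)) r) = r ^ d * V := by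
    intro r hr
    rw [Measure.real, Measure.addHaar_ball volume _ hr, ENNReal.toReal_mul, finrank_euclideanSpace_fin,
      ENNReal.toReal_ofReal (by positivity)]
    rfl
  have hset : ∀ k, ann d k = Metric.ball 0 (2 ^ (k+1)) \ Metric.ball 0 (2 ^ k) := by
    intro k; ext x
    simp [ann, and_comm]
  have h2 : (1:ℝ) < 2 ^ d := one_lt_pow₀ (by norm_num) hd0.ne'
  refine ⟨(2 ^ d - 1) * V, mul_pos (by linarith) hV0, fun k => ⟨?_, ?_⟩⟩
  · rw [hset]
    exact ((measure_mono Set.sdiff_subset).trans_lt measure_ball_lt_top).ne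
  · rw [hset, measureReal_sdiff (Metric.ball_subset_ball (by gcongr <;> norm_num)) measurableSet_ball,
      hball _ (by positivity), hball _ (by positivity), pow_succ, mul_pow]
    ring

lemma hardy (d : ℕ) (hd0 : 0 < d) (α : ℝ) (hα : α ∈ Set.Ioo (0 : ℝ) 2) (hd : α < d) :
    ∃ C : ℝ, 0 ≤ C ∧ ∀ f : EuclideanSpace ℝ (Fin d) → ℝ, Nice f →
      ∀ m : ℕ, (∀ x, (2:ℝ) ^ m ≤ ‖x‖ → f x = 0) →
      ∑ k ∈ Finset.range m, ((2:ℝ) ^ k) ^ (-α) * ∫ x in ann d k, f x ^ 2 ≤ C * fracD d α f := by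
  obtain ⟨v, hv, hvol⟩ := ann_vol d hd0
  set P : ℝ := 2 ^ ((d:ℝ) - α) with hP
  have hP1 : 1 < P := Real.one_lt_rpow (by norm_num) (by linarith)
  set ε := (P - 1) / 2 with hε
  have hε0 : 0 < ε := by rw [hε]; linarith
  set θ := (1 + ε) / P with hθ
  have hθ1 : θ < 1 := by rw [hθ, div_lt_one (by linarith)]; linarith
  have hθ0 : 0 ≤ θ := by rw [hθ]; exact div_nonneg (by linarith) (by linarith)
  set C := (1 + 1 / ε) * 6 ^ ((d:ℝ) + α) / (2 ^ d * v) with hC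
  have hC0 : 0 ≤ C := by positivity
  refine ⟨C / (1 - θ), div_nonneg hC0 (by linarith), fun f hf m hm => ?_⟩
  set b : ℕ → ℝ := fun k => ((2:ℝ) ^ k) ^ (-α) * ∫ x in ann d k, f x ^ 2 with hb
  have hb0 : ∀ k, 0 ≤ b k := fun k =>
    mul_nonneg (by positivity) (integral_nonneg fun x => sq_nonneg _)
  set D : ℕ → ℝ := fun k => ∫ p in ann d k ×ˢ ann d (k+1), qq d α f p ∂(volume.prod volume) with hD
  have hrec : ∀ k, b k ≤ C * D k + θ * b (k + 1) := by
    intro k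
    set X : ℝ := 2 ^ k with hX
    have hX0 : 0 < X := by positivity
    have hs := hardy_step d hd0 α hα f hf (ann d k) (ann d (k+1)) (ann_meas d k) (ann_meas d _)
      (hvol k).1 (hvol _).1 (6 * X) ε hε0 (by
        intro x hx y hy
        have h1 := hx.2
        have h2 := hy.2
        rw [pow_succ] at h1 h2
        rw [pow_succ] at h2
        have := norm_sub_le x y
        linarith)
    rw [(hvol k).2, (hvol _).2] at hs
    have e1 : (2:ℝ) ^ (k+1) = 2 * X := by rw [pow_succ, mul_comm]
    rw [e1, ← hX] at hs
    have hXα : 0 < X ^ α := Real.rpow_pos_of_pos hX0 _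
    have hbk : b k = (X ^ α)⁻¹ * ∫ x in ann d k, f x ^ 2 := by
      simp only [hb]; rw [← hX, Real.rpow_neg hX0.le]
    have hbk1 : b (k+1) = (2 ^ α * X ^ α)⁻¹ * ∫ x in ann d (k+1), f x ^ 2 := by
      simp only [hb]
      rw [e1, Real.rpow_neg (by positivity), Real.mul_rpow (by norm_num) hX0.le]
    have h2α : (0:ℝ) < 2 ^ α := by positivity
    have hP' : P = 2 ^ d / 2 ^ α := by
      rw [hP, Real.rpow_sub (by norm_num), Real.rpow_natCast]
    rw [Real.mul_rpow (by norm_num) hX0.le, Real.rpow_add hX0, Real.rpow_natCast, mul_pow] at hs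
    have hfac : 0 < (2 ^ d * X ^ d * v * X ^ α) := by positivity
    rw [hbk, hbk1]
    refine le_of_mul_le_mul_left ?_ hfac
    calc (2 ^ d * X ^ d * v * X ^ α) * ((X ^ α)⁻¹ * ∫ x in ann d k, f x ^ 2)
        = 2 ^ d * X ^ d * v * ∫ x in ann d k, f x ^ 2 := by field_simp
      _ ≤ _ := hs
      _ = _ := by
        rw [hC, hθ, hP']
        simp only [hD]
        field_simp
  have hDs : ∑ k ∈ Finset.range m, D k ≤ fracD d α f :=
    qq_sub d hd0 α hα f hf (Finset.range m) (fun k => ann d k ×ˢ ann d (k+1))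
      (fun k => (ann_meas d k).prod (ann_meas d _)) (fun i j p hi hj => ann_uniq d i j p.1 hi.1 hj.1)
  have hbm : b m = 0 := by
    simp only [hb]
    rw [setIntegral_eq_zero_of_forall_eq_zero, mul_zero]
    intro x hx
    rw [hm x hx.1]; simp
  have hsum : ∑ k ∈ Finset.range m, b k ≤ C * ∑ k ∈ Finset.range m, D k
      + θ * ∑ k ∈ Finset.range m, b (k+1) := by
    rw [Finset.mul_sum, Finset.mul_sum, ← Finset.sum_add_distrib]
    exact Finset.sum_le_sum fun k _ => hrec k
  have hshift : ∑ k ∈ Finset.range m, b (k+1) ≤ ∑ k ∈ Finset.range m, b k := by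
    have h1 := Finset.sum_range_succ' b m
    have h2 := Finset.sum_range_succ b m
    linarith [hb0 0]
  have h1 := mul_le_mul_of_nonneg_left hshift hθ0
  have h2 := mul_le_mul_of_nonneg_left hDs hC0
  rw [div_mul_eq_mul_div, le_div_iff₀ (by linarith)]
  linarith

/-- Grid cubes. -/
def cube (d : ℕ) (h : ℝ) (k : Fin d → ℤ) : Set (EuclideanSpace ℝ (Fin d)) := {x | ∀ i, ⌊x i / h⌋ = k i}

lemma cube_eq (d : ℕ) (h : ℝ) (hh : 0 < h) (k : Fin d → ℤ) :
    cube d h k = (MeasurableEquiv.toLp 2 (Fin d → ℝ)).symm ⁻¹'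
      (Set.univ.pi fun i => Set.Ico (k i * h) ((k i + 1) * h)) := by
  ext x
  simp only [cube, Set.mem_ofPred_eq, Set.mem_preimage, Set.mem_pi, Set.mem_univ, true_imp_iff,
    Set.mem_Ico]
  refine forall_congr' fun i => ?_
  rw [Int.floor_eq_iff, le_div_iff₀ hh, div_lt_iff₀ hh]
  rfl

lemma cube_meas (d : ℕ) (h : ℝ) (hh : 0 < h) (k : Fin d → ℤ) : MeasurableSet (cube d h k) := by
  rw [cube_eq d h hh]
  exact (MeasurableSet.univ_pi fun i => measurableSet_Ico).preimage (MeasurableEquiv.measurable _)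

lemma cube_vol (d : ℕ) (h : ℝ) (hh : 0 < h) (k : Fin d → ℤ) :
    volume (cube d h k) = ENNReal.ofReal (h ^ d) := by
  rw [cube_eq d h hh, (EuclideanSpace.volume_preserving_symm_measurableEquiv_toLp (Fin d)).measure_preimage
    (MeasurableSet.univ_pi fun i => measurableSet_Ico).nullMeasurableSet, Real.volume_pi_Ico]
  have : ∀ i, ENNReal.ofReal ((k i + 1) * h - k i * h) = ENNReal.ofReal h := by
    intro i; congr 1; ring
  simp [this, ENNReal.ofReal_pow hh.le]

lemma cube_diam (d : ℕ) (hd0 : 0 < d) (h : ℝ) (hh : 0 < h) (k : Fin d → ℤ)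
    (x y : EuclideanSpace ℝ (Fin d)) (hx : x ∈ cube d h k) (hy : y ∈ cube d h k) :
    ‖x - y‖ ≤ d * h := by
  have h1 : ∀ i, (x i - y i) ^ 2 ≤ h ^ 2 := by
    intro i
    have a := Int.floor_eq_iff.1 (hx i)
    have b := Int.floor_eq_iff.1 (hy i)
    rw [le_div_iff₀ hh, div_lt_iff₀ hh] at a b
    rw [sq_le_sq, abs_of_pos hh, abs_le]
    constructor <;> linarith [a.1, a.2, b.1, b.2]
  have h2 : ‖x - y‖ ^ 2 ≤ (d * h) ^ 2 := by
    rw [EuclideanSpace.real_norm_sq_eq]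
    calc ∑ i, (x - y) i ^ 2 ≤ ∑ i : Fin d, h ^ 2 := Finset.sum_le_sum fun i _ => h1 i
      _ = d * h ^ 2 := by simp
      _ ≤ _ := by
        have : (1:ℝ) ≤ d := by exact_mod_cast hd0
        rw [mul_pow]
        have h3 : (d:ℝ) ≤ d ^ 2 := by nlinarith
        exact mul_le_mul_of_nonneg_right h3 (sq_nonneg h)
  exact le_of_sq_le_sq h2 (by positivity)

lemma cube_poincare (d : ℕ) (hd0 : 0 < d) (α : ℝ) (hα : α ∈ Set.Ioo (0 : ℝ) 2)
    (f : EuclideanSpace ℝ (Fin d) → ℝ) (hf : Nice f) (h : ℝ) (hh : 0 < h) (T : Finset (Fin d → ℤ))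
    (h0 : ∀ k ∈ T, ∫ x in cube d h k, f x = 0) :
    ∑ k ∈ T, ∫ x in cube d h k, f x ^ 2 ≤ (d:ℝ) ^ ((d:ℝ) + α) * h ^ α * fracD d α f := by
  have hd1 : (0:ℝ) < d := by exact_mod_cast hd0
  have hsub := qq_sub d hd0 α hα f hf T (fun k => cube d h k ×ˢ cube d h k)
    (fun k => (cube_meas d h hh k).prod (cube_meas d h hh k))
    (fun i j p hi hj => funext fun l => (hi.1 l).symm.trans (hj.1 l))
  refine le_trans ?_ (mul_le_mul_of_nonneg_left hsub (by positivity))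
  rw [Finset.mul_sum]
  refine Finset.sum_le_sum fun k hk => ?_
  have hp := poincare_step d hd0 α hα f hf (cube d h k) (cube_meas d h hh k)
    (by rw [cube_vol d h hh]; exact ENNReal.ofReal_ne_top) (d * h)
    (fun x hx y hy => cube_diam d hd0 h hh k x y hx hy) (h0 k hk)
  have hv : volume.real (cube d h k) = h ^ d := by
    rw [Measure.real, cube_vol d h hh, ENNReal.toReal_ofReal (by positivity)]
  rw [hv, Real.mul_rpow hd1.le hh.le, Real.rpow_add hh, Real.rpow_natCast] at hp
  have hnn : 0 ≤ ∫ x in cube d h k, f x ^ 2 := integral_nonneg fun x => sq_nonneg _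
  have hfac : 0 < h ^ d := by positivity
  refine le_of_mul_le_mul_left ?_ hfac
  have : 0 ≤ h ^ d * ∫ x in cube d h k, f x ^ 2 := mul_nonneg hfac.le hnn
  linarith

lemma tail (d : ℕ) (hd0 : 0 < d) (α β : ℝ) (hα : α ∈ Set.Ioo (0 : ℝ) 2) (hd : α < d) (hαβ : α < β)
    (δ : ℝ) (hδ : 0 < δ) :
    ∃ h : ℝ, 0 < h ∧ ∃ T : Finset (Fin d → ℤ), ∀ f : EuclideanSpace ℝ (Fin d) → ℝ, Nice f →
      (∀ k ∈ T, ∫ x in cube d h k, f x = 0) → wN d β f ≤ δ * fracD d α f := by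
  obtain ⟨C, hC0, hC⟩ := hardy d hd0 α hα hd
  have hd1 : (0:ℝ) < d := by exact_mod_cast hd0
  -- choice of the radius
  obtain ⟨k0, hk0⟩ : ∃ k0 : ℕ, C * ((2:ℝ) ^ k0) ^ (-(β - α)) ≤ δ / 2 := by
    have h1 : Filter.Tendsto (fun k : ℕ => C * ((2:ℝ) ^ k) ^ (-(β - α))) Filter.atTop (nhds (C * 0)) :=
      ((tendsto_rpow_neg_atTop (by linarith : 0 < β - α)).comp
        (tendsto_pow_atTop_atTop_of_one_lt (by norm_num : (1:ℝ) < 2))).const_mul C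
    rw [mul_zero] at h1
    exact (h1.eventually (ge_mem_nhds (by linarith : (0:ℝ) < δ / 2))).exists
  -- choice of the mesh
  set K : ℝ := (d:ℝ) ^ ((d:ℝ) + α) with hK
  have hK0 : 0 < K := Real.rpow_pos_of_pos hd1 _
  set h : ℝ := (δ / 2 / K) ^ (1 / α) with hh
  have hh0 : 0 < h := Real.rpow_pos_of_pos (by positivity) _
  have hhα : K * h ^ α = δ / 2 := by
    rw [hh, ← Real.rpow_mul (by positivity), one_div_mul_cancel hα.1.ne', Real.rpow_one]
    field_simp
  set m0 : ℤ := ⌈(2:ℝ) ^ k0 / h⌉ with hm0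
  let T : Finset (Fin d → ℤ) := Fintype.piFinset fun _ => Finset.Icc (-m0) m0
  have hT : ∀ x : EuclideanSpace ℝ (Fin d), ‖x‖ < 2 ^ k0 → ∃ k ∈ T, x ∈ cube d h k := by
    intro x hx
    refine ⟨fun i => ⌊x i / h⌋, ?_, fun i => rfl⟩
    rw [Fintype.mem_piFinset]
    intro i
    have h1 : |x i| ≤ ‖x‖ := by
      have := PiLp.norm_apply_le x i
      rwa [Real.norm_eq_abs] at this
    have h2 : |x i / h| ≤ m0 := by
      rw [abs_div, abs_of_pos hh0]
      refine le_trans ?_ (Int.le_ceil _)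
      gcongr
      linarith
    rw [abs_le] at h2
    rw [Finset.mem_Icc]
    constructor
    · rw [Int.le_floor]; push_cast; exact h2.1
    · have := (Int.floor_le (x i / h)).trans h2.2
      exact (Int.cast_le (R := ℝ)).1 this
  refine ⟨h, hh0, T, fun f hf h0 => ?_⟩
  obtain ⟨m, hm⟩ : ∃ m : ℕ, ∀ x, (2:ℝ) ^ m ≤ ‖x‖ → f x = 0 := by
    obtain ⟨r, hr⟩ := hf.2.isCompact.isBounded.exists_norm_le
    obtain ⟨m, hm⟩ := pow_unbounded_of_one_lt r (by norm_num : (1:ℝ) < 2)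
    refine ⟨m, fun x hx => ?_⟩
    by_contra hne
    have := hr x (subset_tsupport f hne)
    linarith
  set e0 : ℝ := ((2:ℝ) ^ k0) ^ (-(β - α)) with he0
  have he00 : 0 ≤ e0 := by positivity
  have hsq := nice_sq_int hf
  have hmain : wN d β f ≤ ∑ k ∈ T, (∫ x in cube d h k, f x ^ 2)
      + e0 * ∑ k ∈ Finset.range m, ((2:ℝ) ^ k) ^ (-α) * ∫ x in ann d k, f x ^ 2 := by
    have i1 : ∀ k ∈ T, Integrable ((cube d h k).indicator fun x => f x ^ 2) :=
      fun k _ => hsq.indicator (cube_meas d h hh0 k)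
    have i2 : ∀ k ∈ Finset.range m,
        Integrable (fun x => ((2:ℝ) ^ k) ^ (-α) * (ann d k).indicator (fun x => f x ^ 2) x) :=
      fun k _ => (hsq.indicator (ann_meas d k)).const_mul _
    simp_rw [fun k => (integral_indicator (f := fun x => f x ^ 2) (μ := volume) (cube_meas d h hh0 k)).symm,
      fun k => (integral_indicator (f := fun x => f x ^ 2) (μ := volume) (ann_meas d k)).symm,
      ← integral_const_mul]
    rw [← integral_finsetSum _ i1, ← integral_finsetSum _ i2, ← integral_const_mul,
      ← integral_add (integrable_finsetSum _ i1) ((integrable_finsetSum _ i2).const_mul _)]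
    refine integral_mono (wN_int d β f hf)
      ((integrable_finsetSum _ i1).add ((integrable_finsetSum _ i2).const_mul _)) fun x => ?_
    simp only
    have n1 : ∀ k, 0 ≤ (cube d h k).indicator (fun x => f x ^ 2) x :=
      fun k => Set.indicator_nonneg (fun _ _ => sq_nonneg _) _
    have n2 : ∀ k, 0 ≤ ((2:ℝ) ^ k) ^ (-α) * (ann d k).indicator (fun x => f x ^ 2) x :=
      fun k => mul_nonneg (by positivity) (Set.indicator_nonneg (fun _ _ => sq_nonneg _) _)
    have s1 : 0 ≤ ∑ k ∈ T, (cube d h k).indicator (fun x => f x ^ 2) x :=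
      Finset.sum_nonneg fun k _ => n1 k
    have s2 : 0 ≤ ∑ k ∈ Finset.range m, ((2:ℝ) ^ k) ^ (-α) * (ann d k).indicator (fun x => f x ^ 2) x :=
      Finset.sum_nonneg fun k _ => n2 k
    have s2' := mul_nonneg he00 s2
    by_cases hx0 : f x = 0
    · rw [hx0]; simp only [ne_eq, OfNat.ofNat_ne_zero, not_false_eq_true, zero_pow, zero_mul]
      linarith
    by_cases hxb : ‖x‖ < 2 ^ k0
    · obtain ⟨k, hkT, hxk⟩ := hT x hxb
      have h1 := Finset.single_le_sum (fun k _ => n1 k) hkT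
      rw [Set.indicator_of_mem hxk] at h1
      have h2 : ((1 + ‖x‖) ^ β)⁻¹ ≤ 1 :=
        inv_le_one_of_one_le₀ (Real.one_le_rpow (by linarith [norm_nonneg x]) (by linarith [hα.1]))
      have h3 : f x ^ 2 * ((1 + ‖x‖) ^ β)⁻¹ ≤ f x ^ 2 :=
        mul_le_of_le_one_right (sq_nonneg _) h2
      linarith
    · push Not at hxb
      have hx1 : 1 ≤ ‖x‖ := (one_le_pow₀ (by norm_num)).trans hxb
      obtain ⟨k, hk1, hk2⟩ := exists_nat_pow_near hx1 (by norm_num : (1:ℝ) < 2)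
      have hxm : ‖x‖ < 2 ^ m := by
        by_contra hc
        exact hx0 (hm x (not_lt.1 hc))
      have hkm : k < m := (pow_lt_pow_iff_right₀ (by norm_num : (1:ℝ) < 2)).1 (hk1.trans_lt hxm)
      have hkk0 : k0 ≤ k := by
        have := (pow_lt_pow_iff_right₀ (by norm_num : (1:ℝ) < 2)).1 (hxb.trans_lt hk2)
        omega
      have h1 := Finset.single_le_sum (fun k _ => n2 k) (Finset.mem_range.2 hkm)
      rw [Set.indicator_of_mem (show x ∈ ann d k from ⟨hk1, hk2⟩)] at h1
      have hX : (0:ℝ) < 2 ^ k := by positivity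
      have h2 : ((1 + ‖x‖) ^ β)⁻¹ ≤ e0 * ((2:ℝ) ^ k) ^ (-α) := by
        calc ((1 + ‖x‖) ^ β)⁻¹ ≤ (((2:ℝ) ^ k) ^ β)⁻¹ := by
              refine inv_anti₀ (by positivity) (Real.rpow_le_rpow hX.le ?_ (by linarith [hα.1]))
              linarith
          _ = ((2:ℝ) ^ k) ^ (-(β - α)) * ((2:ℝ) ^ k) ^ (-α) := by
              rw [← Real.rpow_add hX, ← Real.rpow_neg hX.le]; congr 1; ring
          _ ≤ _ := by
              refine mul_le_mul_of_nonneg_right ?_ (by positivity)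
              refine Real.rpow_le_rpow_of_nonpos (by positivity) ?_ (by linarith)
              exact pow_le_pow_right₀ (by norm_num) hkk0
      calc f x ^ 2 * ((1 + ‖x‖) ^ β)⁻¹ ≤ f x ^ 2 * (e0 * ((2:ℝ) ^ k) ^ (-α)) :=
            mul_le_mul_of_nonneg_left h2 (sq_nonneg _)
        _ = e0 * (((2:ℝ) ^ k) ^ (-α) * f x ^ 2) := by ring
        _ ≤ _ := by
            have := mul_le_mul_of_nonneg_left h1 he00
            linarith
  have hc := cube_poincare d hd0 α hα f hf h hh0 T h0
  rw [← hK, hhα] at hc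
  have hH := mul_le_mul_of_nonneg_left (hC f hf m hm) he00
  have hDn := fracD_nonneg d α f
  have h5 := mul_le_mul_of_nonneg_right hk0 hDn
  calc wN d β f ≤ _ := hmain
    _ ≤ δ / 2 * fracD d α f + e0 * (C * fracD d α f) := add_le_add hc hH
    _ ≤ δ * fracD d α f := by linarith

theorem compactness_iff_beta_gt_alpha
    (d : ℕ) (α β : ℝ) (hα : α ∈ Set.Ioo (0 : ℝ) 2) (hd : α < d) (hβ : 0 ≤ β) :
    Filter.Tendsto
        (fun n : ℕ =>
          minMaxLevel d α (fun x : EuclideanSpace ℝ (Fin d) => (1 + ‖x‖) ^ β) n)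
        Filter.atTop Filter.atTop
      ↔ α < β := by
  have hd0 : 0 < d := by
    have : (0:ℝ) < d := hα.1.trans hd
    exact_mod_cast this
  obtain ⟨C, hC0, hC⟩ := good_space d hd0 α hα
  have hlev : ∀ n, minMaxLevel d α (fun x : EuclideanSpace ℝ (Fin d) => (1 + ‖x‖) ^ β) n =
      sInf { Λ : ℝ | ∃ F : Submodule ℝ (EuclideanSpace ℝ (Fin d) → ℝ),
        Module.finrank ℝ F = n ∧ (∀ f ∈ F, Nice f) ∧
        Λ = sSup { t : ℝ | ∃ f ∈ F, f ≠ 0 ∧ t = fracD d α f / wN d β f } } := fun n => rfl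
  constructor
  · intro hT
    by_contra hβα
    push Not at hβα
    obtain ⟨n, hn⟩ := (hT.eventually (Filter.eventually_gt_atTop C)).exists
    rw [hlev] at hn
    obtain ⟨F, hF1, hF2, hF3⟩ := hC n
    refine absurd hn (not_lt.2 ?_)
    refine le_trans (b := sSup { t : ℝ | ∃ f ∈ F, f ≠ 0 ∧ t = fracD d α f / wN d β f })
      (csInf_le ?_ ?_) ?_
    · refine ⟨0, ?_⟩
      rintro Λ ⟨G, _, _, rfl⟩
      refine Real.sSup_nonneg ?_
      rintro t ⟨f, _, _, rfl⟩
      exact div_nonneg (fracD_nonneg _ _ _) (wN_nonneg _ _ _)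
    · exact ⟨F, hF1, hF2, rfl⟩
    · refine Real.sSup_le ?_ hC0
      rintro t ⟨f, hf, hf0, rfl⟩
      rw [div_le_iff₀ (wN_pos d β f (hF2 f hf) hf0)]
      exact hF3 f hf β hβα
  · intro hαβ
    rw [Filter.tendsto_atTop]
    intro M
    set M' := max M 1 with hM'
    have hM0 : 0 < M' := lt_of_lt_of_le one_pos (le_max_right _ _)
    obtain ⟨h, hh, T, hTb⟩ := tail d hd0 α β hα hd hαβ M'⁻¹ (by positivity)
    filter_upwards [Filter.eventually_gt_atTop T.card] with n hn
    rw [hlev]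
    obtain ⟨F0, hF1, hF2, -⟩ := hC n
    refine le_csInf ?_ ?_
    · exact ⟨_, ⟨F0, hF1, hF2, rfl⟩⟩
    rintro Λ ⟨F, hFn, hFN, rfl⟩
    have hpos : 0 < Module.finrank ℝ F := by omega
    have : FiniteDimensional ℝ F := Module.finite_of_finrank_pos hpos
    let L : F →ₗ[ℝ] (T → ℝ) :=
      { toFun := fun f k => ∫ x in cube d h k, (f : EuclideanSpace ℝ (Fin d) → ℝ) x
        map_add' := by
          intro f g
          ext k
          exact integral_add (nice_int (hFN _ f.2)).restrict (nice_int (hFN _ g.2)).restrict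
        map_smul' := by
          intro c f
          ext k
          exact integral_const_mul c _ }
    have hker : LinearMap.ker L ≠ ⊥ := by
      apply LinearMap.ker_ne_bot_of_finrank_lt
      rw [Module.finrank_fintype_fun_eq_card, Fintype.card_coe]
      omega
    obtain ⟨f, hfk, hf0⟩ := Submodule.exists_mem_ne_zero_of_ne_bot hker
    have hf0' : (f : EuclideanSpace ℝ (Fin d) → ℝ) ≠ 0 := fun h => hf0 (Subtype.ext h)
    have hNf := hFN _ f.2
    have hb := hTb f hNf (fun k hk => congrFun (LinearMap.mem_ker.1 hfk) ⟨k, hk⟩)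
    have hw := wN_pos d β f hNf hf0'
    have hq : M' ≤ fracD d α f / wN d β f := by
      rw [le_div_iff₀ hw]
      rw [inv_mul_eq_div, le_div_iff₀ hM0] at hb
      linarith
    exact (le_max_left M 1).trans (hq.trans (le_csSup (quot_bdd d hd0 α β hα F hpos hFN)
      ⟨f, f.2, hf0', rfl⟩))
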